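/- Let G be a bipartite graph with partite sets X and Y with |X| = 3 that admits a planar (crossing-free) 1-disc O_X drawing. Then at most one vertex of Y has degree 3, and consequently |E(G)| ≤ 2|Y| + 1. -/

import Mathlib

open Set unitInterval

/-- A drawing of a simple graph in the plane: vertices are mapped to distinct
points and every edge to a simple arc joining the images of its endpoints,
which meets no vertex point other than its own endpoints. -/
structure SimpleGraph.Drawing {V : Type*} (G : SimpleGraph V) where
  pos : V → ℝ × ℝ
  posInj : Function.Injective pos
  arc : ∀ ⦃u v : V⦄, G.Adj u v → _root_.Path (pos u) (pos v)
  arc_symm : ∀ ⦃u v : V⦄ (h : G.Adj u v), arc h.symm = (arc h).symm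
  arc_inj : ∀ ⦃u v : V⦄ (h : G.Adj u v), Function.Injective (arc h)
  arc_avoid : ∀ ⦃u v : V⦄ (h : G.Adj u v) (t : I) (w : V),
      (arc h) t = pos w → w = u ∨ w = v

namespace SimpleGraph.Drawing

variable {V : Type*} {G : SimpleGraph V} (D : G.Drawing)

/-- The interior (open part) of the arc drawn for an edge. -/
def arcInterior ⦃u v : V⦄ (h : G.Adj u v) : Set (ℝ × ℝ) :=
  (D.arc h) '' {t : I | t ≠ 0 ∧ t ≠ 1}

/-- The set of crossing points of the drawing: points lying in the interiors of
the arcs of two distinct edges. -/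
def crossings : Set (ℝ × ℝ) :=
  {p | ∃ (u v u' v' : V) (h : G.Adj u v) (h' : G.Adj u' v'),
      s(u, v) ≠ s(u', v') ∧ p ∈ D.arcInterior h ∧ p ∈ D.arcInterior h'}

/-- A drawing is 1-planar if it has finitely many crossings and each edge is
crossed at most once. -/
def Is1Planar : Prop :=
  D.crossings.Finite ∧
    ∀ ⦃u v : V⦄ (h : G.Adj u v), (D.arcInterior h ∩ D.crossings).Subsingleton

/-- A drawing is crossing-free (a plane drawing) if it has no crossings. -/
def IsCrossingFree : Prop := D.crossings = ∅

end SimpleGraph.Drawing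

/-- A graph is 1-planar if it admits a drawing in which each edge is crossed
at most once. -/
def SimpleGraph.Is1Planar {V : Type*} (G : SimpleGraph V) : Prop :=
  ∃ D : G.Drawing, D.Is1Planar

/-- A graph is planar if it admits a crossing-free drawing in the plane. -/
def SimpleGraph.IsPlanarDrawable {V : Type*} (G : SimpleGraph V) : Prop :=
  ∃ D : G.Drawing, D.IsCrossingFree

/-- `X`, `Y` form a bipartition of `G`: they partition the vertex set and every
edge joins a vertex of `X` to a vertex of `Y`. -/
def SimpleGraph.IsBipartitionOf {V : Type*} (G : SimpleGraph V) (X Y : Set V) : Prop :=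
  Disjoint X Y ∧ X ∪ Y = Set.univ ∧
    ∀ ⦃u v : V⦄, G.Adj u v → (u ∈ X ∧ v ∈ Y) ∨ (u ∈ Y ∧ v ∈ X)

/-- A 1-disc `O_X` drawing: all vertices of `X` lie on the boundary circle of
the disc with centre `O` and radius `r`, and all other vertices and all edges
lie in the open disc. -/
def SimpleGraph.Drawing.IsOneDisc {V : Type*} {G : SimpleGraph V} (D : G.Drawing)
    (X : Set V) (O : ℝ × ℝ) (r : ℝ) : Prop :=
  0 < r ∧ (∀ v ∈ X, D.pos v ∈ Metric.sphere O r) ∧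
    (∀ v ∉ X, D.pos v ∈ Metric.ball O r) ∧
    ∀ ⦃u v : V⦄ (h : G.Adj u v), D.arcInterior h ⊆ Metric.ball O r

/-- A nowhere vanishing continuous function on the plane has a continuous argument with any
prescribed admissible value at a given point. -/
theorem exists_continuous_arg_lift {F : ℝ × ℝ → ℂ} (hF : Continuous F) (hF0 : ∀ x, F x ≠ 0)
    (x₀ : ℝ × ℝ) (c : ℝ) (hc : (c : Real.Angle) = (F x₀).arg) :
    ∃ θ : ℝ × ℝ → ℝ, Continuous θ ∧ θ x₀ = c ∧ ∀ x, (θ x : Real.Angle) = (F x).arg := by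
  have hcont : Continuous fun x => ((F x).arg : Real.Angle) :=
    continuous_iff_continuousAt.2 fun x =>
      (Complex.continuousAt_arg_coe_angle (hF0 x)).comp (f := F) hF.continuousAt
  obtain ⟨θ, ⟨h₀, hθ⟩, -⟩ :=
    (AddCircle.isCoveringMap_coe (2 * Real.pi)).existsUnique_continuousMap_lifts
      ⟨fun x => ((F x).arg : Real.Angle), hcont⟩ x₀ c hc
  exact ⟨θ, θ.continuous, h₀, fun x => congrFun hθ x⟩

/-- The difference of two continuous real functions on a preconnected space is constant if it is
constant modulo `2π`. -/
theorem sub_eq_sub_of_angle_eq {A : Type*} [TopologicalSpace A] [PreconnectedSpace A]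
    {f g : A → ℝ} (hf : Continuous f) (hg : Continuous g) {c : Real.Angle}
    (h : ∀ x, (f x : Real.Angle) - g x = c) (x y : A) : f x - g x = f y - g y := by
  refine (AddCircle.isCoveringMap_coe (2 * Real.pi)).const_of_comp (hf.sub hg) ?_ x y
  intro a b
  change ((f a - g a : ℝ) : Real.Angle) = ((f b - g b : ℝ) : Real.Angle)
  rw [Real.Angle.coe_sub, Real.Angle.coe_sub, h, h]

/-- The variation of a continuous argument of a function with values in a closed half-plane
`{z | 0 ≤ re (n * z)}` without the origin depends on the end values only. -/
theorem arg_lift_sub_eq_of_half_plane {A : Type*} [TopologicalSpace A] [PreconnectedSpace A]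
    {F : A → ℂ} (hF : Continuous F) (hF0 : ∀ x, F x ≠ 0) {θ : A → ℝ} (hθ : Continuous θ)
    (hθF : ∀ x, (θ x : Real.Angle) = (F x).arg) {n : ℂ} (hn : n ≠ 0)
    (hre : ∀ x, 0 ≤ (n * F x).re) (x y : A) :
    θ y - θ x = (n * F y).arg - (n * F x).arg := by
  have hcont : Continuous fun x => (n * F x).arg := by
    refine continuous_iff_continuousAt.2 fun x => ?_
    have hmem : n * F x ∈ Complex.slitPlane := by
      rcases (hre x).lt_or_eq with h | h
      · exact Or.inl h
      · exact Or.inr fun him => mul_ne_zero hn (hF0 x) (Complex.ext h.symm him)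
    exact (Complex.continuousAt_arg hmem).comp (f := fun x => n * F x)
      (continuous_const.mul hF).continuousAt
  have key := sub_eq_sub_of_angle_eq (c := -(n.arg : Real.Angle)) hθ hcont
    (fun x => by rw [hθF, Complex.arg_mul_coe_angle hn (hF0 x)]; abel) x y
  linarith

/-- Two tripods with the same three feet `p i`, each foot lying on a supporting line of both
tripods, cannot have all legs with different feet disjoint. -/
theorem false_of_disjoint_tripods {p n : Fin 3 → ℂ} {a b : ℂ} {α β : Fin 3 → ℝ → ℂ}
    (hn : ∀ i, n i ≠ 0) (hα : ∀ i, Continuous (α i)) (hβ : ∀ i, Continuous (β i))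
    (hα0 : ∀ i, α i 0 = a) (hβ0 : ∀ i, β i 0 = b)
    (hα1 : ∀ i, α i 1 = p i) (hβ1 : ∀ i, β i 1 = p i)
    (hdisj : ∀ i j, i ≠ j → ∀ s t, α i s ≠ β j t)
    (hαn : ∀ i j s, 0 ≤ (n i * (p i - α j s)).re)
    (hβn : ∀ i j s, 0 ≤ (n i * (p i - β j s)).re) : False := by
  have lift : ∀ i j, ∃ θ : ℝ × ℝ → ℝ, i ≠ j → Continuous θ ∧ θ (0, 0) = (a - b).arg ∧
      ∀ x, (θ x : Real.Angle) = (α i x.1 - β j x.2).arg := by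
    intro i j
    by_cases hij : i = j
    · exact ⟨0, fun h => absurd hij h⟩
    · obtain ⟨θ, h⟩ := exists_continuous_arg_lift (F := fun x => α i x.1 - β j x.2)
        (((hα i).comp continuous_fst).sub ((hβ j).comp continuous_snd))
        (fun x => sub_ne_zero.2 (hdisj i j hij _ _)) (0, 0) (a - b).arg (by simp [hα0, hβ0])
      exact ⟨θ, fun _ => h⟩
  choose θ hθ using lift
  have hleft : ∀ i j k, i ≠ j → i ≠ k → θ i j (1, 0) = θ i k (1, 0) := by
    intro i j k hj hk
    obtain ⟨hc, h0, hl⟩ := hθ i j hj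
    obtain ⟨hc', h0', hl'⟩ := hθ i k hk
    have := sub_eq_sub_of_angle_eq (f := fun s => θ i j (s, 0)) (g := fun s => θ i k (s, 0))
      (c := 0) (by fun_prop) (by fun_prop) (fun s => by simp [hl, hl', hβ0]) 0 1
    simp only [h0, h0'] at this
    linarith
  have hright : ∀ i j k, j ≠ i → k ≠ i → θ j i (0, 1) = θ k i (0, 1) := by
    intro i j k hj hk
    obtain ⟨hc, h0, hl⟩ := hθ j i hj
    obtain ⟨hc', h0', hl'⟩ := hθ k i hk
    have := sub_eq_sub_of_angle_eq (f := fun s => θ j i (0, s)) (g := fun s => θ k i (0, s))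
      (c := 0) (by fun_prop) (by fun_prop) (fun s => by simp [hl, hl', hα0]) 0 1
    simp only [h0, h0'] at this
    linarith
  have turnLeft : ∀ i j k, i ≠ j → i ≠ k → θ i k (1, 1) - θ i j (1, 1) =
      (n i * (p i - p k)).arg - (n i * (p i - p j)).arg := by
    intro i j k hj hk
    have half : ∀ j, i ≠ j → θ i j (1, 1) - θ i j (1, 0) =
        (n i * (p i - p j)).arg - (n i * (p i - b)).arg := by
      intro j hj
      obtain ⟨hc, -, hl⟩ := hθ i j hj
      have := arg_lift_sub_eq_of_half_plane (F := fun t => p i - β j t)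
        (θ := fun t => θ i j (1, t)) (continuous_const.sub (hβ j))
        (fun t => sub_ne_zero.2 (hα1 i ▸ hdisj i j hj 1 t)) (by fun_prop)
        (fun t => by simp [hl, hα1]) (hn i) (fun t => hβn i j t) 0 1
      simpa [hβ0, hβ1] using this
    linarith [half j hj, half k hk, hleft i j k hj hk]
  have turnRight : ∀ i j k, j ≠ i → k ≠ i → θ k i (1, 1) - θ j i (1, 1) =
      (n i * (p i - p k)).arg - (n i * (p i - p j)).arg := by
    intro i j k hj hk
    have half : ∀ j, j ≠ i → θ j i (1, 1) - θ j i (0, 1) =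
        (n i * (p i - p j)).arg - (n i * (p i - a)).arg := by
      intro j hj
      obtain ⟨hc, -, hl⟩ := hθ j i hj
      have hmul : ∀ z, -n i * (z - p i) = n i * (p i - z) := fun z => by ring
      have := arg_lift_sub_eq_of_half_plane (F := fun s => α j s - p i)
        (θ := fun s => θ j i (s, 1)) ((hα j).sub continuous_const)
        (fun s => sub_ne_zero.2 (hβ1 i ▸ hdisj j i hj s 1)) (by fun_prop)
        (fun s => by simp [hl, hβ1]) (neg_ne_zero.2 (hn i))
        (fun s => by rw [hmul]; exact hαn i j s) 0 1
      simpa only [hmul, hα0, hα1] using this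
    linarith [half j hj, half k hk, hright i j k hj hk]
  have h01 : (0 : Fin 3) ≠ 1 := by decide
  have h02 : (0 : Fin 3) ≠ 2 := by decide
  have h12 : (1 : Fin 3) ≠ 2 := by decide
  have heq : θ 1 0 (1, 1) = θ 0 1 (1, 1) := by
    linarith [turnLeft 0 1 2 h01 h02, turnRight 2 0 1 h02 h12, turnLeft 1 2 0 h12 h01.symm,
      turnRight 0 1 2 h01.symm h02.symm, turnLeft 2 0 1 h02.symm h12.symm,
      turnRight 1 2 0 h12.symm h01]
  have hne : p 0 - p 1 ≠ 0 := sub_ne_zero.2 (hα1 0 ▸ hβ1 1 ▸ hdisj 0 1 h01 1 1)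
  have harg : ((p 1 - p 0).arg : Real.Angle) = (p 0 - p 1).arg := by
    have h₁ := (hθ 1 0 h01.symm).2.2 (1, 1)
    have h₂ := (hθ 0 1 h01).2.2 (1, 1)
    simp only [hα1, hβ1] at h₁ h₂
    rw [← h₁, ← h₂, heq]
  rw [← neg_sub, Complex.arg_neg_coe_angle hne] at harg
  exact Real.Angle.pi_ne_zero (by simpa using harg)

/-- A point of a sphere of `ℝ × ℝ` lies on a supporting line of the closed ball. -/
theorem exists_supporting_functional {O p : ℝ × ℝ} {r : ℝ} (hp : p ∈ Metric.sphere O r) :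
    ∃ n : ℂ, n ≠ 0 ∧ ∀ q ∈ Metric.closedBall O r,
      0 ≤ (n * (Complex.equivRealProdCLM.symm p - Complex.equivRealProdCLM.symm q)).re := by
  obtain ⟨n, hn, h⟩ : ∃ n : ℂ, n ≠ 0 ∧ ∀ q ∈ Metric.closedBall O r,
      0 ≤ n.re * (p.1 - q.1) - n.im * (p.2 - q.2) := by
    rw [mem_sphere_iff_norm, Prod.norm_def, Prod.fst_sub, Prod.snd_sub, Real.norm_eq_abs,
      Real.norm_eq_abs] at hp
    have hball : ∀ q ∈ Metric.closedBall O r, |q.1 - O.1| ≤ r ∧ |q.2 - O.2| ≤ r := fun q hq => by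
      simpa [Prod.dist_eq, Real.dist_eq] using Metric.mem_closedBall.1 hq
    rcases max_choice |p.1 - O.1| |p.2 - O.2| with hm | hm <;> rw [hm] at hp
    · rcases abs_choice (p.1 - O.1) with ha | ha <;> rw [ha] at hp
      · exact ⟨1, one_ne_zero, fun q hq => by
          have := abs_le.1 (hball q hq).1; simp; linarith⟩
      · exact ⟨-1, by simp, fun q hq => by
          have := abs_le.1 (hball q hq).1; simp; linarith⟩
    · rcases abs_choice (p.2 - O.2) with ha | ha <;> rw [ha] at hp
      · exact ⟨-Complex.I, by simp, fun q hq => by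
          have := abs_le.1 (hball q hq).2; simp; linarith⟩
      · exact ⟨Complex.I, by simp, fun q hq => by
          have := abs_le.1 (hball q hq).2; simp; linarith⟩
  exact ⟨n, hn, fun q hq => by simpa using h q hq⟩

namespace SimpleGraph.Drawing

variable {V : Type*} {G : SimpleGraph V}

/-- In a crossing-free drawing, edges with no common endpoint are drawn disjointly. -/
theorem IsCrossingFree.arc_ne {D : G.Drawing} (hfree : D.IsCrossingFree) {u v u' v' : V}
    (h : G.Adj u v) (h' : G.Adj u' v') (huu : u ≠ u') (huv : u ≠ v') (hvu : v ≠ u')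
    (hvv : v ≠ v') (s t : I) : D.arc h s ≠ D.arc h' t := by
  intro heq
  by_cases hs0 : s = 0
  · subst hs0
    have := D.arc_avoid h' t u (by rw [← heq, Path.source])
    tauto
  by_cases hs1 : s = 1
  · subst hs1
    have := D.arc_avoid h' t v (by rw [← heq, Path.target])
    tauto
  by_cases ht0 : t = 0
  · subst ht0
    have := D.arc_avoid h s u' (by rw [heq, Path.source])
    tauto
  by_cases ht1 : t = 1
  · subst ht1
    have := D.arc_avoid h s v' (by rw [heq, Path.target])
    tauto
  have hmem : D.arc h s ∈ D.crossings :=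
    ⟨u, v, u', v', h, h', by simp [huu, huv], ⟨s, ⟨hs0, hs1⟩, rfl⟩,
      ⟨t, ⟨ht0, ht1⟩, heq.symm⟩⟩
  rw [hfree] at hmem
  exact hmem

/-- The arcs of a 1-disc drawing lie in the closed disc. -/
theorem IsOneDisc.arc_mem_closedBall {D : G.Drawing} {X : Set V} {O : ℝ × ℝ} {r : ℝ}
    (hdisc : D.IsOneDisc X O r) {u v : V} (h : G.Adj u v) (t : I) :
    D.arc h t ∈ Metric.closedBall O r := by
  obtain ⟨-, hX, hY, hE⟩ := hdisc
  have hpos : ∀ w, D.pos w ∈ Metric.closedBall O r := fun w => by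
    by_cases hw : w ∈ X
    · exact Metric.sphere_subset_closedBall (hX w hw)
    · exact Metric.ball_subset_closedBall (hY w hw)
  by_cases h0 : t = 0
  · subst h0; rw [Path.source]; exact hpos u
  by_cases h1 : t = 1
  · subst h1; rw [Path.target]; exact hpos v
  exact Metric.ball_subset_closedBall (hE h ⟨t, ⟨h0, h1⟩, rfl⟩)

/-- In a crossing-free 1-disc drawing, two vertices outside `X` do not have three common
neighbours in `X`. -/
theorem IsOneDisc.eq_of_three_common_neighbors {D : G.Drawing} {X : Set V} {O : ℝ × ℝ} {r : ℝ}
    (hdisc : D.IsOneDisc X O r) (hfree : D.IsCrossingFree) {y z : V} (hy : y ∉ X) (hz : z ∉ X)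
    {x : Fin 3 → V} (hx : Function.Injective x) (hxX : ∀ i, x i ∈ X)
    (hyx : ∀ i, G.Adj y (x i)) (hzx : ∀ i, G.Adj z (x i)) : y = z := by
  by_contra hyz
  choose n hn hsupp using fun i => exists_supporting_functional (hdisc.2.1 (x i) (hxX i))
  set e := Complex.equivRealProdCLM.symm
  refine false_of_disjoint_tripods (p := fun i => e (D.pos (x i))) (n := n)
    (a := e (D.pos y)) (b := e (D.pos z))
    (α := fun i s => e ((D.arc (hyx i)).extend s)) (β := fun i s => e ((D.arc (hzx i)).extend s))
    hn (fun i => e.continuous.comp (Path.continuous_extend _))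
    (fun i => e.continuous.comp (Path.continuous_extend _)) (by simp) (by simp) (by simp) (by simp)
    ?_ (fun i j s => hsupp i _ (hdisc.arc_mem_closedBall _ _))
    (fun i j s => hsupp i _ (hdisc.arc_mem_closedBall _ _))
  intro i j hij s t heq
  exact hfree.arc_ne (hyx i) (hzx j) hyz (fun h => hy (h ▸ hxX j)) (fun h => hz (h ▸ hxX i))
    (hx.ne hij) _ _ (e.injective heq)

end SimpleGraph.Drawing

/-- Let `G` be a bipartite graph with partite sets `X`, `Y`,
`|X| = 3`, admitting a planar (crossing-free) 1-disc `O_X` drawing.  Then at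
most one vertex of `Y` has degree `3`, and consequently `|E(G)| ≤ 2|Y| + 1`. -/
theorem crossing_free_one_disc_bound {V : Type*} [Fintype V] [DecidableEq V]
    (G : SimpleGraph V) [DecidableRel G.Adj] (X Y : Set V)
    (hbip : G.IsBipartitionOf X Y) (hX : X.ncard = 3)
    (D : G.Drawing) (O : ℝ × ℝ) (r : ℝ)
    (hfree : D.IsCrossingFree) (hdisc : D.IsOneDisc X O r) :
    {y | y ∈ Y ∧ G.degree y = 3}.ncard ≤ 1 ∧
      (G.edgeFinset.card : ℤ) ≤ 2 * Y.ncard + 1 := by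
  obtain ⟨hXY, huniv, hadj⟩ := hbip
  have hbw : G.IsBipartiteWith (X : Set V) Y := ⟨hXY, hadj⟩
  have hYX : ∀ y ∈ Y, y ∉ X := fun y hy hyX => Set.disjoint_left.1 hXY hyX hy
  have hsub : ∀ y ∈ Y, (G.neighborFinset y : Set V) ⊆ X := fun y hy v hv =>
    hbw.symm.mem_of_mem_adj hy (by simpa using hv)
  have hdeg : ∀ y ∈ Y, G.degree y ≤ 3 := fun y hy => by
    have := Set.ncard_le_ncard (hsub y hy)
    rwa [Set.ncard_coe_finset, hX] at this
  have hfull : ∀ y ∈ Y, G.degree y = 3 → ∀ v ∈ X, G.Adj y v := fun y hy h v hv => by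
    have := Set.eq_of_subset_of_ncard_le (hsub y hy) (by rw [Set.ncard_coe_finset, hX]; exact h.ge)
    rw [← this] at hv
    simpa using hv
  have hone : {y | y ∈ Y ∧ G.degree y = 3}.ncard ≤ 1 := by
    rw [Set.ncard_le_one]
    rintro y ⟨hy, hy3⟩ z ⟨hz, hz3⟩
    let x : Fin 3 ≃ X := (Finite.equivFinOfCardEq hX).symm
    exact hdisc.eq_of_three_common_neighbors hfree (hYX y hy) (hYX z hz)
      (Subtype.val_injective.comp x.injective) (fun i => (x i).2)
      (fun i => hfull y hy hy3 _ (x i).2) (fun i => hfull z hz hz3 _ (x i).2)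
  refine ⟨hone, ?_⟩
  classical
  have hsum : ∑ v ∈ Y.toFinset, G.degree v = G.edgeFinset.card :=
    SimpleGraph.isBipartiteWith_sum_degrees_eq_card_edges (t := X.toFinset) (by simpa using hbw.symm)
  have hthree : {y | y ∈ Y ∧ G.degree y = 3} = ↑{y ∈ Y.toFinset | G.degree y = 3} := by
    ext; simp
  rw [hthree, Set.ncard_coe_finset] at hone
  have hle : ∑ v ∈ Y.toFinset, G.degree v ≤
      ∑ v ∈ Y.toFinset, (2 + if G.degree v = 3 then 1 else 0) := by
    refine Finset.sum_le_sum fun v hv => ?_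
    have := hdeg v (by simpa using hv)
    split_ifs <;> omega
  rw [Finset.sum_add_distrib, Finset.sum_const, smul_eq_mul, ← Finset.card_filter, hsum,
    ← Set.ncard_eq_toFinset_card'] at hle
  omega
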